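/- arXiv:1907.10156 — 5 statements merged into one kernel-verified Lean document; each statement's English description precedes it below -/
import Mathlib

section
/- For a nonempty finite index set ι, a probability vector o on ι with all entries strictly positive, a score vector p : ι → ℝ, and λ > 0, the maximizer of q ↦ Σ_j q_j·p_j − λ·KL(q‖o) over the probability simplex is unique: if q ∈ Δ satisfies Σ_j q_j·p_j − λ·KL(q‖o) = Σ_j q*_j·p_j − λ·KL(q*‖o), where q*_j = o_j·exp(p_j/λ)/Σ_i o_i·exp(p_i/λ), then q = q*. -/
open Real Finset

/-- A nonnegative vector with the same mass as a positive vector `r`, at zero Kullback-Leibler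
divergence from `r`, equals `r`. -/
lemma eq_of_sum_mul_log_div_eq_zero {ι : Type*} [Fintype ι] {q r : ι → ℝ}
    (hq : ∀ j, 0 ≤ q j) (hr : ∀ j, 0 < r j) (hqr : ∑ j, q j = ∑ j, r j)
    (h : ∑ j, q j * log (q j / r j) = 0) : q = r := by
  have hdiv (j : ι) : 0 ≤ q j / r j := div_nonneg (hq j) (hr j).le
  have hterm (j : ι) :
      r j * InformationTheory.klFun (q j / r j) = q j * log (q j / r j) + (r j - q j) := by
    have := (hr j).ne'
    rw [InformationTheory.klFun_apply]
    field_simp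
    ring
  have hsum : ∑ j, r j * InformationTheory.klFun (q j / r j) = 0 := by
    simp only [hterm, sum_add_distrib, sum_sub_distrib, h, hqr]
    ring
  rw [sum_eq_zero_iff_of_nonneg
    fun j _ => mul_nonneg (hr j).le (InformationTheory.klFun_nonneg (hdiv j))] at hsum
  funext j
  have hj := (mul_eq_zero.mp (hsum j (mem_univ j))).resolve_left (hr j).ne'
  rwa [InformationTheory.klFun_eq_zero_iff (hdiv j), div_eq_one_iff_eq (hr j).ne'] at hj

/-- The Gibbs variational identity, for a vector of total mass one. -/
lemma sum_mul_sub_mul_sum_mul_log_div {ι : Type*} [Fintype ι] {o p q : ι → ℝ} {lam Z : ℝ}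
    (ho : ∀ j, 0 < o j) (hlam : lam ≠ 0) (hZ : Z ≠ 0) (hq : ∑ j, q j = 1) :
    (∑ j, q j * p j) - lam * (∑ j, q j * log (q j / o j)) =
      lam * log Z - lam * ∑ j, q j * log (q j / (o j * exp (p j / lam) / Z)) := by
  have hterm (j : ι) : q j * p j - lam * (q j * log (q j / o j)) =
      q j * (lam * log Z) - lam * (q j * log (q j / (o j * exp (p j / lam) / Z))) := by
    rcases eq_or_ne (q j) 0 with h0 | h0
    · simp [h0]
    · have hoj := (ho j).ne'
      have he := (exp_pos (p j / lam)).ne'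
      rw [log_div h0 hoj, log_div h0 (div_ne_zero (mul_ne_zero hoj he) hZ),
        log_div (mul_ne_zero hoj he) hZ, log_mul hoj he, log_exp]
      field_simp
      ring
  rw [mul_sum, ← sum_sub_distrib, sum_congr rfl fun j _ => hterm j, sum_sub_distrib,
    ← sum_mul, hq, one_mul, ← mul_sum]

/-- Uniqueness of the maximizer in the paper's Proposition 1: any `q` in the
probability simplex attaining the same value of the objective
`q ↦ ∑ j, q j * p j − λ * KL(q‖o)` as `q* j = o j * exp (p j / λ) / Z`
must equal `q*`. -/
theorem dr_loss_prop1_unique {ι : Type*} [Fintype ι] [Nonempty ι]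
    (o : ι → ℝ) (ho : ∀ j, 0 < o j) (ho1 : ∑ j, o j = 1)
    (p : ι → ℝ) (lam : ℝ) (hlam : 0 < lam) :
    let qs : ι → ℝ := fun j => o j * exp (p j / lam) / ∑ i, o i * exp (p i / lam)
    ∀ q : ι → ℝ, (∀ j, 0 ≤ q j) → (∑ j, q j = 1) →
      (∑ j, q j * p j) - lam * (∑ j, q j * log (q j / o j)) =
        (∑ j, qs j * p j) - lam * (∑ j, qs j * log (qs j / o j)) →
      q = qs := by
  intro qs q hq hq1 h
  have hZ : 0 < ∑ i, o i * exp (p i / lam) :=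
    sum_pos (fun i _ => mul_pos (ho i) (exp_pos _)) univ_nonempty
  have hqs (j : ι) : 0 < qs j := div_pos (mul_pos (ho j) (exp_pos _)) hZ
  have hqs1 : ∑ j, qs j = 1 := by
    simp only [qs, ← sum_div]
    exact div_self hZ.ne'
  have hself : ∑ j, qs j * log (qs j / qs j) = 0 :=
    sum_eq_zero fun j _ => by rw [div_self (hqs j).ne', log_one, mul_zero]
  rw [sum_mul_sub_mul_sum_mul_log_div ho hlam.ne' hZ.ne' hq1,
    sum_mul_sub_mul_sum_mul_log_div ho hlam.ne' hZ.ne' hqs1] at h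
  have hkl : ∑ j, q j * log (q j / qs j) = ∑ j, qs j * log (qs j / qs j) :=
    mul_left_cancel₀ hlam.ne' (sub_right_injective h)
  exact eq_of_sum_mul_log_div_eq_zero hq hqs (hq1.trans hqs1.symm) (hkl.trans hself)
end

section
/- For a nonempty finite index set ι, a probability vector o on ι with all entries strictly positive, a score vector p : ι → ℝ, and λ > 0, let q*_j = o_j·exp(p_j/λ)/Σ_i o_i·exp(p_i/λ) and ε = KL(q*‖o). Then q* solves the constrained problem: for every q in the probability simplex with KL(q‖o) ≤ ε, one has Σ_j q_j·p_j ≤ Σ_j q*_j·p_j. -/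
open Real Finset

/-- Pointwise Gibbs inequality: `a - b ≤ a * log (a / b)`. -/
lemma sub_le_mul_log_div {a b : ℝ} (ha : 0 ≤ a) (hb : 0 < b) :
    a - b ≤ a * log (a / b) := by
  rcases ha.eq_or_lt with rfl | ha
  · simpa using hb.le
  · have h := mul_le_mul_of_nonneg_left (one_sub_inv_le_log_of_pos (div_pos ha hb)) ha.le
    rwa [inv_div, mul_sub, mul_one, mul_div_cancel₀ _ ha.ne'] at h

/-- Lagrangian duality claim: with `q* j = o j * exp (p j / λ) / Z` and
`ε = KL(q*‖o)`, the distribution `q*` solves the KL-constrained problem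
`max_{q ∈ Δ, KL(q‖o) ≤ ε} ∑ j, q j * p j`. -/
theorem dr_loss_constrained_opt {ι : Type*} [Fintype ι] [Nonempty ι]
    (o : ι → ℝ) (ho : ∀ j, 0 < o j) (ho1 : ∑ j, o j = 1)
    (p : ι → ℝ) (lam : ℝ) (hlam : 0 < lam) :
    let qs : ι → ℝ := fun j => o j * exp (p j / lam) / ∑ i, o i * exp (p i / lam)
    let eps : ℝ := ∑ j, qs j * log (qs j / o j)
    ∀ q : ι → ℝ, (∀ j, 0 ≤ q j) → (∑ j, q j = 1) →
      (∑ j, q j * log (q j / o j)) ≤ eps →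
      ∑ j, q j * p j ≤ ∑ j, qs j * p j := by
  intro qs eps q hq hq1 hle
  set Z := ∑ i, o i * exp (p i / lam)
  have hZpos : 0 < Z :=
    sum_pos (fun i _ => mul_pos (ho i) (exp_pos _)) univ_nonempty
  have hqs_pos : ∀ j, 0 < qs j := fun j => div_pos (mul_pos (ho j) (exp_pos _)) hZpos
  have hqs_sum : ∑ j, qs j = 1 := by
    simp only [qs, ← sum_div]
    exact div_self hZpos.ne'
  have hlog : ∀ j, log (qs j / o j) = p j / lam - log Z := fun j => by
    have h : qs j / o j = exp (p j / lam) / Z := by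
      change o j * exp (p j / lam) / Z / o j = _
      rw [div_right_comm, mul_div_cancel_left₀ _ (ho j).ne']
    rw [h, log_div (exp_pos _).ne' hZpos.ne', log_exp]
  have hsum : ∀ r : ι → ℝ, ∑ j, r j = 1 →
      ∑ j, r j * log (qs j / o j) = (∑ j, r j * p j) / lam - log Z := fun r hr => by
    simp only [hlog, mul_sub, sum_sub_distrib, ← sum_mul, hr, one_mul, sum_div, mul_div_assoc]
  have hgibbs : ∑ j, q j * log (qs j / o j) ≤ ∑ j, q j * log (q j / o j) := by
    have hterm : ∀ j, q j * log (qs j / o j) + (q j - qs j) ≤ q j * log (q j / o j) := fun j => by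
      have h := sub_le_mul_log_div (hq j) (hqs_pos j)
      rcases (hq j).eq_or_lt with h0 | h0
      · simpa [← h0] using (hqs_pos j).le
      · rw [log_div h0.ne' (hqs_pos j).ne'] at h
        rw [log_div h0.ne' (ho j).ne', log_div (hqs_pos j).ne' (ho j).ne']
        linarith
    have h := sum_le_sum fun j (_ : j ∈ univ) => hterm j
    rw [sum_add_distrib, sum_sub_distrib, hq1, hqs_sum] at h
    linarith
  have h := hgibbs.trans hle
  rw [hsum q hq1, show eps = _ from hsum qs hqs_sum] at h
  exact (div_le_div_iff_of_pos_right hlam).1 (by linarith)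
end

section
/- For a nonempty finite index set ι, a probability vector o on ι with all entries strictly positive, and a score vector p : ι → ℝ, the regularized expectation F(λ) = Σ_j (o_j·exp(p_j/λ)/Σ_i o_i·exp(p_i/λ))·p_j converges to max_j p_j as λ → 0⁺. -/
open Real Finset Filter

/-- For `x ≤ 0`, `exp (x / t)` converges to the indicator of `x = 0` as `t → 0⁺`. -/
lemma tendsto_exp_div_nhdsGT_zero_of_nonpos {x : ℝ} (hx : x ≤ 0) :
    Tendsto (fun t : ℝ => Real.exp (x / t)) (nhdsWithin 0 (Set.Ioi 0))
      (nhds (if x = 0 then 1 else 0)) := by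
  split_ifs with h
  · simp [h]
  · refine Real.tendsto_exp_atBot.comp ?_
    exact tendsto_inv_nhdsGT_zero.const_mul_atTop_of_neg (lt_of_le_of_ne hx h)

/-- Exponential weights are invariant under a common shift of the scores. -/
lemma exp_weight_div_sum_shift {ι : Type*} [Fintype ι] (o p : ι → ℝ) (M t : ℝ) (j : ι) :
    o j * Real.exp (p j / t) / ∑ i, o i * Real.exp (p i / t) =
      o j * Real.exp ((p j - M) / t) / ∑ i, o i * Real.exp ((p i - M) / t) := by
  have h (i : ι) : o i * Real.exp (p i / t) =
      o i * Real.exp ((p i - M) / t) * Real.exp (M / t) := by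
    rw [mul_assoc, ← Real.exp_add, ← add_div, sub_add_cancel]
  simp_rw [h, ← Finset.sum_mul]
  exact mul_div_mul_right _ _ (Real.exp_ne_zero _)

/-- As `λ → 0⁺`, the regularized expectation
`F(λ) = ∑ j, (o j * exp (p j / λ) / Z(λ)) * p j` converges to `max_j p j`,
i.e. the derived distribution approaches the worst-case distribution. -/
theorem dr_loss_lambda_to_zero {ι : Type*} [Fintype ι] [Nonempty ι]
    (o : ι → ℝ) (ho : ∀ j, 0 < o j) (ho1 : ∑ j, o j = 1) (p : ι → ℝ) :
    Tendsto
      (fun lam : ℝ => ∑ j, (o j * exp (p j / lam) / ∑ i, o i * exp (p i / lam)) * p j)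
      (nhdsWithin 0 (Set.Ioi 0))
      (nhds (Finset.univ.sup' Finset.univ_nonempty p)) := by
  obtain ⟨k, -, hk⟩ := Finset.exists_mem_eq_sup' Finset.univ_nonempty p
  set M := Finset.univ.sup' Finset.univ_nonempty p
  have hM (j : ι) : p j ≤ M := Finset.le_sup' p (Finset.mem_univ j)
  let L : ι → ℝ := fun j => o j * if p j - M = 0 then 1 else 0
  have hL (j : ι) : Tendsto (fun t : ℝ => o j * Real.exp ((p j - M) / t))
      (nhdsWithin 0 (Set.Ioi 0)) (nhds (L j)) :=
    (tendsto_exp_div_nhdsGT_zero_of_nonpos (sub_nonpos.2 (hM j))).const_mul (o j)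
  have hL_nonneg (j : ι) : 0 ≤ L j := mul_nonneg (ho j).le (by split_ifs <;> norm_num)
  have hL_pos : 0 < ∑ j, L j :=
    Finset.sum_pos' (fun j _ => hL_nonneg j) ⟨k, Finset.mem_univ k, by simp [L, hk, ho k]⟩
  have hLp (j : ι) : L j * p j = L j * M := by
    by_cases h : p j - M = 0
    · rw [sub_eq_zero.1 h]
    · simp [L, h]
  have hlim : ∑ j, L j / (∑ i, L i) * p j = M := by
    simp_rw [div_mul_eq_mul_div, hLp, ← Finset.sum_div, ← Finset.sum_mul]
    exact mul_div_cancel_left₀ M hL_pos.ne'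
  simp_rw [exp_weight_div_sum_shift o p M]
  have key : Tendsto
      (fun t : ℝ => ∑ j, (o j * Real.exp ((p j - M) / t) /
        ∑ i, o i * Real.exp ((p i - M) / t)) * p j)
      (nhdsWithin 0 (Set.Ioi 0)) (nhds (∑ j, L j / (∑ i, L i) * p j)) :=
    tendsto_finsetSum _ fun j _ =>
      ((hL j).div (tendsto_finsetSum _ fun i _ => hL i) hL_pos.ne').mul_const (p j)
  rwa [hlim] at key
end

section
/- Let E be a real inner product space and L : E → ℝ a nonnegative differentiable function with μ-Lipschitz gradient (μ > 0), with L(θ_0) > 0 at the deterministic initialization θ_0. Let (θ_t) be a random sequence updated by SGD, θ_{t+1} = θ_t − η·g_t, where each mini-batch gradient g_t satisfies E[g_t | F_t] = ∇L(θ_t) and E[‖g_t − ∇L(θ_t)‖² | F_t] ≤ δ²/m almost surely (δ > 0, batch size m ≥ 1). If the learning rate is set to η = √(2m·L(θ_0))/(δ·√(μT)) and this η satisfies η ≤ 1/μ, then (1/T)·Σ_{t=0}^{T−1} E[‖∇L(θ_t)‖²] ≤ 2δ·√(2μ·L(θ_0))/√(mT). -/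
open MeasureTheory Finset

/-- The descent lemma: a function with `K`-Lipschitz gradient is bounded above by its quadratic
model with curvature `K`. -/
theorem apply_add_le_of_lipschitzWith_gradient {E : Type*} [NormedAddCommGroup E]
    [InnerProductSpace ℝ E] [CompleteSpace E] {f : E → ℝ} {K : NNReal}
    (hf : Differentiable ℝ f) (hlip : LipschitzWith K (gradient f)) (x v : E) :
    f (x + v) ≤ f x + inner ℝ (gradient f x) v + K / 2 * ‖v‖ ^ 2 := by
  have hderiv (s : ℝ) :
      HasDerivAt
        (fun s : ℝ => f (x + s • v) - s * inner ℝ (gradient f x) v - K / 2 * s ^ 2 * ‖v‖ ^ 2)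
        (inner ℝ (gradient f (x + s • v)) v - inner ℝ (gradient f x) v - K * s * ‖v‖ ^ 2) s := by
    have hline : HasDerivAt (fun s : ℝ => x + s • v) v s := by
      simpa using ((hasDerivAt_id s).smul_const v).const_add x
    have hcomp := (hf (x + s • v)).hasFDerivAt.comp_hasDerivAt s hline
    rw [← inner_gradient_left] at hcomp
    have hlin := (hasDerivAt_id s).mul_const (inner ℝ (gradient f x) v)
    have hquad := (((hasDerivAt_id s).pow 2).const_mul (K / 2 : ℝ)).mul_const (‖v‖ ^ 2)
    refine ((hcomp.sub hlin).sub hquad).congr_deriv ?_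
    simp only [id_eq, Nat.cast_ofNat]
    ring
  have hanti := antitoneOn_of_deriv_nonpos (convex_Icc (0 : ℝ) 1)
    (fun s _ => (hderiv s).continuousAt.continuousWithinAt)
    (fun s _ => (hderiv s).differentiableAt.differentiableWithinAt)
    (fun s hs => by
      rw [interior_Icc] at hs
      rw [(hderiv s).deriv, ← inner_sub_left]
      have hnorm : ‖gradient f (x + s • v) - gradient f x‖ ≤ K * (s * ‖v‖) := by
        have := hlip.norm_sub_le (x + s • v) x
        rwa [add_sub_cancel_left, norm_smul, Real.norm_of_nonneg hs.1.le] at this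
      have hcs := real_inner_le_norm (gradient f (x + s • v) - gradient f x) v
      nlinarith [mul_le_mul_of_nonneg_right hnorm (norm_nonneg v)])
  have h := hanti (Set.left_mem_Icc.2 zero_le_one) (Set.right_mem_Icc.2 zero_le_one) zero_le_one
  simp only [one_smul, zero_smul, add_zero] at h
  linarith

section

variable {E : Type*} [NormedAddCommGroup E] [InnerProductSpace ℝ E]
  {Ω : Type*} {m m0 : MeasurableSpace Ω} {P : Measure Ω}

theorem integrable_inner_of_integrable_sq {X Y : Ω → E}
    (hX : AEStronglyMeasurable X P) (hY : AEStronglyMeasurable Y P)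
    (hX2 : Integrable (fun ω => ‖X ω‖ ^ 2) P) (hY2 : Integrable (fun ω => ‖Y ω‖ ^ 2) P) :
    Integrable (fun ω => inner ℝ (X ω) (Y ω)) P := by
  refine (hX2.add hY2).mono' (hX.inner hY) (ae_of_all _ fun ω => ?_)
  have := norm_inner_le_norm (𝕜 := ℝ) (X ω) (Y ω)
  simp only [Pi.add_apply]
  nlinarith [sq_nonneg (‖X ω‖ - ‖Y ω‖), sq_nonneg ‖X ω‖, sq_nonneg ‖Y ω‖]

theorem integral_inner_eq_zero_of_condExp_eq_zero [CompleteSpace E] [IsFiniteMeasure P]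
    (hm : m ≤ m0) {X Y : Ω → E} (hX : StronglyMeasurable[m] X) (hY : Integrable Y P)
    (hXY : Integrable (fun ω => inner ℝ (X ω) (Y ω)) P) (hY0 : P[Y | m] =ᵐ[P] 0) :
    ∫ ω, inner ℝ (X ω) (Y ω) ∂P = 0 := by
  have hpull : P[fun ω => inner ℝ (X ω) (Y ω) | m] =ᵐ[P] fun ω => inner ℝ (X ω) (P[Y | m] ω) :=
    condExp_bilin_of_stronglyMeasurable_left (innerSL ℝ) hX hXY hY
  rw [← integral_condExp hm]
  refine integral_eq_zero_of_ae ?_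
  filter_upwards [hpull, hY0] with ω h1 h2
  simp [h1, h2]

/-- Expected decrease of a smooth function along one stochastic gradient step. -/
theorem integral_comp_sgd_step_le [CompleteSpace E] [IsProbabilityMeasure P] (hm : m ≤ m0)
    {L : E → ℝ} {K : NNReal} (hdiff : Differentiable ℝ L) (hlip : LipschitzWith K (gradient L))
    {x g : Ω → E} {η σ : ℝ} (hη : 0 ≤ η) (hηK : K * η ≤ 1)
    (hx : StronglyMeasurable[m] x) (hg : Integrable g P)
    (hunbiased : P[g | m] =ᵐ[P] fun ω => gradient L (x ω))
    (hvarint : Integrable (fun ω => ‖g ω - gradient L (x ω)‖ ^ 2) P)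
    (hvar : ∀ᵐ ω ∂P, (P[fun ω' => ‖g ω' - gradient L (x ω')‖ ^ 2 | m]) ω ≤ σ)
    (hLx : Integrable (fun ω => L (x ω)) P)
    (hLx' : Integrable (fun ω => L (x ω - η • g ω)) P)
    (hgrad : Integrable (fun ω => ‖gradient L (x ω)‖ ^ 2) P) :
    ∫ ω, L (x ω - η • g ω) ∂P ≤
      ∫ ω, L (x ω) ∂P - η / 2 * ∫ ω, ‖gradient L (x ω)‖ ^ 2 ∂P + K * η ^ 2 / 2 * σ := by
  have hGm : StronglyMeasurable[m] (fun ω => gradient L (x ω)) :=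
    hlip.continuous.comp_stronglyMeasurable hx
  have hG : Integrable (fun ω => gradient L (x ω)) P := integrable_condExp.congr hunbiased
  have hN : Integrable (fun ω => g ω - gradient L (x ω)) P := hg.sub hG
  have hGN := integrable_inner_of_integrable_sq hG.1 hN.1 hgrad hvarint
  have hN0 : P[fun ω => g ω - gradient L (x ω) | m] =ᵐ[P] 0 := by
    have hsub := condExp_sub hg hG m
    rw [condExp_of_stronglyMeasurable hm hGm hG] at hsub
    filter_upwards [hsub, hunbiased] with ω h1 h2
    refine h1.trans ?_
    simp [h2]
  have hcross := integral_inner_eq_zero_of_condExp_eq_zero hm hGm hN hGN hN0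
  have hvar' : ∫ ω, ‖g ω - gradient L (x ω)‖ ^ 2 ∂P ≤ σ := by
    rw [← integral_condExp hm]
    simpa using integral_mono_ae integrable_condExp (integrable_const σ) hvar
  have hpoint (ω : Ω) : L (x ω - η • g ω) ≤
      L (x ω) - η / 2 * ‖gradient L (x ω)‖ ^ 2
        + K * η ^ 2 / 2 * ‖g ω - gradient L (x ω)‖ ^ 2
        + (K * η ^ 2 - η) * inner ℝ (gradient L (x ω)) (g ω - gradient L (x ω)) := by
    have h := apply_add_le_of_lipschitzWith_gradient hdiff hlip (x ω) (-(η • g ω))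
    have hsq := norm_add_sq_real (gradient L (x ω)) (g ω - gradient L (x ω))
    rw [add_sub_cancel] at hsq
    rw [← sub_eq_add_neg, norm_neg, norm_smul, mul_pow, hsq, Real.norm_eq_abs, sq_abs,
      inner_neg_right, inner_smul_right] at h
    have hin := inner_sub_right (𝕜 := ℝ) (gradient L (x ω)) (g ω) (gradient L (x ω))
    rw [real_inner_self_eq_norm_sq] at hin
    have hcoef : 0 ≤ η * (1 - K * η) * ‖gradient L (x ω)‖ ^ 2 :=
      mul_nonneg (mul_nonneg hη (sub_nonneg.2 hηK)) (sq_nonneg _)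
    have hin' : inner ℝ (gradient L (x ω)) (g ω) =
        ‖gradient L (x ω)‖ ^ 2 + inner ℝ (gradient L (x ω)) (g ω - gradient L (x ω)) := by
      linarith
    rw [hin'] at h
    linarith
  have hint1 := hLx.sub (hgrad.const_mul (η / 2))
  have hint2 := hint1.add (hvarint.const_mul (K * η ^ 2 / 2))
  have hmono := integral_mono hLx' (hint2.add (hGN.const_mul (K * η ^ 2 - η))) hpoint
  rw [integral_add' hint2 (hGN.const_mul _), integral_add' hint1 (hvarint.const_mul _),
    integral_sub' hLx (hgrad.const_mul _), integral_const_mul, integral_const_mul,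
    integral_const_mul, hcross, mul_zero, add_zero] at hmono
  exact hmono.trans (by gcongr)

end

/-- Paper's Theorem 1: for nonnegative `K`-smooth `L` with `L(θ_0) > 0`, SGD
with conditionally unbiased mini-batch gradients of conditional variance at
most `δ²/m` and learning rate `η = √(2 m L(θ_0)) / (δ √(K T))` (assumed
`≤ 1/K`) satisfies `(1/T) ∑_{t<T} E[‖∇L(θ_t)‖²] ≤ 2 δ √(2 K L(θ_0)) / √(m T)`. -/
theorem sgd_convergence_rate {E : Type*} [NormedAddCommGroup E]
    [InnerProductSpace ℝ E] [CompleteSpace E]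
    {Ω : Type*} {m0 : MeasurableSpace Ω} {P : Measure Ω} [IsProbabilityMeasure P]
    (F : Filtration ℕ m0)
    (L : E → ℝ) (K : ℝ) (hK : 0 < K)
    (hL0 : ∀ x, 0 ≤ L x)
    (hdiff : Differentiable ℝ L)
    (hlip : LipschitzWith (Real.toNNReal K) (gradient L))
    (T : ℕ) (hT : 0 < T) (θ g : ℕ → Ω → E) (η δ : ℝ) (hδ : 0 < δ)
    (m : ℕ) (hm : 1 ≤ m)
    (θ0 : E) (hθ0 : θ 0 = fun _ => θ0) (hLθ0 : 0 < L θ0)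
    (hηdef : η = Real.sqrt (2 * m * L θ0) / (δ * Real.sqrt (K * T)))
    (hηK : η ≤ 1 / K)
    (hadapted : ∀ t, StronglyMeasurable[F t] (θ t))
    (hupdate : ∀ t ω, θ (t + 1) ω = θ t ω - η • g t ω)
    (hgint : ∀ t, Integrable (g t) P)
    (hunbiased : ∀ t, P[g t | F t] =ᵐ[P] fun ω => gradient L (θ t ω))
    (hvarint : ∀ t, Integrable (fun ω => ‖g t ω - gradient L (θ t ω)‖ ^ 2) P)
    (hvar : ∀ t, ∀ᵐ ω ∂P,
      (P[fun ω' => ‖g t ω' - gradient L (θ t ω')‖ ^ 2 | F t]) ω ≤ δ ^ 2 / m)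
    (hLint : ∀ t, Integrable (fun ω => L (θ t ω)) P)
    (hgradint : ∀ t, Integrable (fun ω => ‖gradient L (θ t ω)‖ ^ 2) P) :
    (1 / T : ℝ) * ∑ t ∈ Finset.range T, ∫ ω, ‖gradient L (θ t ω)‖ ^ 2 ∂P ≤
      2 * δ * Real.sqrt (2 * K * L θ0) / Real.sqrt (m * T) := by
  have hT' : (0 : ℝ) < T := by exact_mod_cast hT
  have hm' : (0 : ℝ) < m := by exact_mod_cast hm
  have hη : 0 < η := by rw [hηdef]; positivity
  have hKη : (K.toNNReal : ℝ) * η ≤ 1 := by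
    rw [Real.coe_toNNReal K hK.le, mul_comm]
    exact (le_div_iff₀ hK).1 hηK
  have hstep (t : ℕ) : ∫ ω, L (θ (t + 1) ω) ∂P ≤
      ∫ ω, L (θ t ω) ∂P - η / 2 * ∫ ω, ‖gradient L (θ t ω)‖ ^ 2 ∂P
        + K * η ^ 2 / 2 * (δ ^ 2 / m) := by
    have hnext := hLint (t + 1)
    simp only [hupdate t] at hnext ⊢
    simpa only [Real.coe_toNNReal K hK.le] using
      integral_comp_sgd_step_le (F.le t) hdiff hlip hη.le hKη (hadapted t) (hgint t)
        (hunbiased t) (hvarint t) (hvar t) (hLint t) hnext (hgradint t)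
  have htelescope (n : ℕ) :
      ∫ ω, L (θ n ω) ∂P + η / 2 * ∑ t ∈ Finset.range n, ∫ ω, ‖gradient L (θ t ω)‖ ^ 2 ∂P ≤
        L θ0 + n * (K * η ^ 2 / 2 * (δ ^ 2 / m)) := by
    induction n with
    | zero => simp [hθ0]
    | succ n ih =>
      rw [Finset.sum_range_succ]
      push_cast
      linarith [hstep n]
  have hnonneg : 0 ≤ ∫ ω, L (θ T ω) ∂P := integral_nonneg fun ω => hL0 _
  have hnoise : T * (K * η ^ 2 / 2 * (δ ^ 2 / m)) = L θ0 := by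
    rw [hηdef, div_pow, mul_pow, Real.sq_sqrt (by positivity), Real.sq_sqrt (by positivity)]
    field_simp
  have hsum : ∑ t ∈ Finset.range T, ∫ ω, ‖gradient L (θ t ω)‖ ^ 2 ∂P ≤ 4 * L θ0 / η := by
    rw [le_div_iff₀ hη]
    linarith [htelescope T]
  refine (mul_le_mul_of_nonneg_left hsum (by positivity)).trans_eq ?_
  rw [hηdef, Real.sqrt_mul (by positivity), Real.sqrt_mul zero_le_two, Real.sqrt_mul hK.le,
    Real.sqrt_mul (by positivity) (L θ0), Real.sqrt_mul zero_le_two, Real.sqrt_mul hm'.le]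
  have hT2 := Real.sq_sqrt hT'.le
  have hL2 := Real.sq_sqrt hLθ0.le
  have h2 := Real.sq_sqrt (zero_le_two (α := ℝ))
  have hTs := Real.sqrt_pos.2 hT'
  have hLs := Real.sqrt_pos.2 hLθ0
  have hms := Real.sqrt_pos.2 hm'
  have h2s := Real.sqrt_pos.2 (zero_lt_two (α := ℝ))
  generalize Real.sqrt T = b at *
  generalize Real.sqrt (L θ0) = a at *
  generalize Real.sqrt 2 = w at *
  rw [← hT2, ← hL2]
  field_simp
  rw [h2]
  ring
end

section
/- Fix λ > 0 and a nonempty finite index set ι. The soft-min weighted expectation P̂₊ : (ι → ℝ) → ℝ defined by P̂₊(p) = Σ_j q_j(p)·p_j, where q_j(p) = exp(−p_j/λ)/Σ_i exp(−p_i/λ), is differentiable, and its partial derivative with respect to the coordinate p_k equals q_k(p)·(1 − (p_k − P̂₊(p))/λ) for every k ∈ ι. -/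
open Real Finset

theorem hasFDerivAt_sum_comp_apply {ι : Type*} [Fintype ι] {f : ℝ → ℝ} {f' : ℝ → ℝ}
    (hf : ∀ x, HasDerivAt f (f' x) x) (p : ι → ℝ) :
    HasFDerivAt (fun p : ι → ℝ => ∑ j, f (p j))
      (∑ j, f' (p j) • ContinuousLinearMap.proj (R := ℝ) (φ := fun _ : ι => ℝ) j) p :=
  HasFDerivAt.fun_sum fun j _ => (hf (p j)).comp_hasFDerivAt p (hasFDerivAt_apply j p)

/-- The soft-min weighted expectation `P̂₊(p) = ∑ j, q j p_j` with
`q j = exp(−p j / λ) / ∑ i, exp(−p i / λ)` is differentiable, with partial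
derivative in `p k` equal to `q k * (1 − (p k − P̂₊(p)) / λ)`
(gradient formula from the paper's appendix). -/
theorem softmin_expectation_grad {ι : Type*} [Fintype ι] [Nonempty ι] [DecidableEq ι]
    (lam : ℝ) (hlam : 0 < lam) :
    let q : (ι → ℝ) → ι → ℝ := fun p j => exp (-p j / lam) / ∑ i, exp (-p i / lam)
    let Pp : (ι → ℝ) → ℝ := fun p => ∑ j, q p j * p j
    Differentiable ℝ Pp ∧
      ∀ (p : ι → ℝ) (k : ι),
        fderiv ℝ Pp p (Pi.single k 1) = q p k * (1 - (p k - Pp p) / lam) := by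
  intro q Pp
  have hZpos : ∀ p : ι → ℝ, 0 < ∑ i, exp (-p i / lam) := fun p =>
    Finset.sum_pos (fun i _ => exp_pos _) Finset.univ_nonempty
  have hexp : ∀ x : ℝ, HasDerivAt (fun x => exp (-x / lam)) (exp (-x / lam) * (-1 / lam)) x :=
    fun x => ((hasDerivAt_id x).neg.div_const lam).exp
  have hmul : ∀ x : ℝ, HasDerivAt (fun x => exp (-x / lam) * x)
      (exp (-x / lam) * (-1 / lam) * x + exp (-x / lam) * 1) x :=
    fun x => (hexp x).mul (hasDerivAt_id x)
  have hPp : Pp = fun p => (∑ j, exp (-p j / lam) * p j) *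
      (Inv.inv ∘ fun p : ι → ℝ => ∑ i, exp (-p i / lam)) p := by
    funext p
    simp only [Pp, q, Function.comp_apply, Finset.sum_mul]
    exact Finset.sum_congr rfl fun j _ => by ring
  have hderiv := fun p : ι → ℝ =>
    (hasFDerivAt_sum_comp_apply hmul p).fun_mul
      ((hasDerivAt_inv (hZpos p).ne').comp_hasFDerivAt p (hasFDerivAt_sum_comp_apply hexp p))
  refine ⟨fun p => ?_, fun p k => ?_⟩
  · rw [hPp]
    exact (hderiv p).differentiableAt
  · rw [hPp, (hderiv p).fderiv]
    have hZ := (hZpos p).ne'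
    simp only [q, Function.comp_apply, add_apply, smul_apply,
      _root_.sum_apply, ContinuousLinearMap.proj_apply, Pi.single_apply, smul_eq_mul,
      mul_ite, mul_one, mul_zero, Finset.sum_ite_eq', Finset.mem_univ, if_true]
    field_simp
    ring
end
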